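/- For all x, y ∈ B^d and all n ≥ 0, the reproducing kernel P_n(·,·) of V_n^d satisfies P_n(x,y) = ((n+d/2)/(d/2)) σ_d^{-1} ∫_{S^{d-1}} C_n^{d/2}(⟨x,ξ⟩) C_n^{d/2}(⟨y,ξ⟩) dω(ξ). -/

import Mathlib

open MeasureTheory Real Finset Filter Topology RealInnerProductSpace

noncomputable section

/-- `ℝ^d` with the Euclidean structure. -/
abbrev Esp (d : ℕ) := EuclideanSpace ℝ (Fin d)

/-- The Radon transform `R f(ξ, t)`: integral of `f` over the hyperplane `⟨ξ, x⟩ = t`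
intersected with the closed unit ball `B^d` (for `f` supported in `B^d` this is the integral
over the whole hyperplane). -/
def radon {d : ℕ} (f : Esp d → ℝ) (ξ : Esp d) (t : ℝ) : ℝ :=
  ∫ y in {y : ((ℝ ∙ ξ)ᗮ : Submodule ℝ (Esp d)) |
      t • ξ + (y : Esp d) ∈ Metric.closedBall (0 : Esp d) 1},
    f (t • ξ + (y : Esp d))

/-- The surface measure `dω` on the unit sphere `S^{d-1}`. -/
def sphereMeasure (d : ℕ) : Measure (Metric.sphere (0 : Esp d) 1) :=
  (volume : Measure (Esp d)).toSphere

/-- `σ_d = 2 π^{d/2} / Γ(d/2)`, the surface area of `S^{d-1}`. -/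
def sigmaConst (d : ℕ) : ℝ := 2 * Real.pi ^ ((d : ℝ) / 2) / Real.Gamma ((d : ℝ) / 2)

/-- `b_d = π^{d/2} / Γ((d+2)/2)`, the volume of the unit ball `B^d`. -/
def ballVol (d : ℕ) : ℝ := Real.pi ^ ((d : ℝ) / 2) / Real.Gamma (((d : ℝ) + 2) / 2)

/-- `c_λ = Γ(1/2) Γ(λ+1/2) / Γ(λ+1)`, normalization constant of `(1-t²)^{λ-1/2}` on `[-1,1]`. -/
def cConst (lam : ℝ) : ℝ := Real.Gamma (1 / 2) * Real.Gamma (lam + 1 / 2) / Real.Gamma (lam + 1)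

/-- Pochhammer symbol `(a)_k = a (a+1) ⋯ (a+k-1)`. -/
def poch (a : ℝ) (k : ℕ) : ℝ := ∏ i ∈ Finset.range k, (a + i)

/-- The Gegenbauer polynomial `C_n^λ(t)`, normalized by
`c_λ ∫_{-1}^1 C_k^λ C_l^λ (1-t²)^{λ-1/2} dt = (λ (2λ)_k / ((k+λ) k!)) δ_{k,l}`. -/
def gegen (lam : ℝ) (n : ℕ) (t : ℝ) : ℝ :=
  ∑ k ∈ Finset.range (n / 2 + 1),
    (-1 : ℝ) ^ k * Real.Gamma ((n : ℝ) - k + lam) /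
      (Real.Gamma lam * (Nat.factorial k) * (Nat.factorial (n - 2 * k))) * (2 * t) ^ (n - 2 * k)

/-- `h_n^{(λ)} = λ (2λ)_n / ((n+λ) n!)`, the square of the norm of `C_n^λ`. -/
def hGegen (lam : ℝ) (n : ℕ) : ℝ := lam * poch (2 * lam) n / (((n : ℝ) + lam) * n.factorial)

/-- The kernel `Φ_n(t,u) = Σ_{k=0}^n ((k+d/2)/(d/2)) C_k^{d/2}(t) C_k^{d/2}(u)`. -/
def Phi (d n : ℕ) (t u : ℝ) : ℝ :=
  ∑ k ∈ Finset.range (n + 1),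
    (((k : ℝ) + (d : ℝ) / 2) / ((d : ℝ) / 2)) * gegen ((d : ℝ) / 2) k t * gegen ((d : ℝ) / 2) k u

/-- The Jacobi polynomial `P_n^{(a,b)}`. -/
def jacobiP (a b : ℝ) (n : ℕ) (x : ℝ) : ℝ :=
  ∑ s ∈ Finset.range (n + 1),
    (Real.Gamma (a + n + 1) / (Real.Gamma (a + s + 1) * Nat.factorial (n - s))) *
      (Real.Gamma (b + n + 1) / (Real.Gamma (b + (n : ℝ) - s + 1) * Nat.factorial s)) *
      ((x - 1) / 2) ^ s * ((x + 1) / 2) ^ (n - s)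

/-- `h_k^{(a,b)}`, the square of the norm of `P_k^{(a,b)}` for the normalized Jacobi weight. -/
def hJacobi (a b : ℝ) (k : ℕ) : ℝ :=
  poch (a + 1) k * poch (b + 1) k * (a + b + k + 1) /
    (k.factorial * poch (a + b + 2) k * (a + b + 2 * k + 1))

/-- The orthonormal Jacobi polynomial `p_k^{(a,b)} = [h_k^{(a,b)}]^{-1/2} P_k^{(a,b)}`. -/
def jacobiOrtho (a b : ℝ) (k : ℕ) (x : ℝ) : ℝ := jacobiP a b k x / Real.sqrt (hJacobi a b k)

/-- The constant `h_{n,k}` with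
`h_{n,k}² = Γ((d+2)/2) Γ(n-2k+d/2) / (Γ(d/2) Γ(n-2k+(d+2)/2))`. -/
def hnk (d n k : ℕ) : ℝ :=
  Real.sqrt (Real.Gamma (((d : ℝ) + 2) / 2) * Real.Gamma ((n : ℝ) - 2 * k + (d : ℝ) / 2) /
    (Real.Gamma ((d : ℝ) / 2) * Real.Gamma ((n : ℝ) - 2 * k + ((d : ℝ) + 2) / 2)))

/-- The orthonormal basis element
`f_{k,j}^n(x) = h_{n,k}^{-1} p_k^{(0, n-2k+(d-2)/2)}(2‖x‖²-1) Y(x)` of `V_n^d`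
(for the Lebesgue measure, i.e. `μ = 1/2`), built from a spherical harmonic `Y` of
degree `n - 2k`. -/
def fkjBasis (d n k : ℕ) (Y : Esp d → ℝ) (x : Esp d) : ℝ :=
  (hnk d n k)⁻¹ * jacobiOrtho 0 ((n : ℝ) - 2 * k + ((d : ℝ) - 2) / 2) k (2 * ‖x‖ ^ 2 - 1) * Y x

/-- `g_{k,j}^n(ξ,t) = [h_n^{(d/2)}]^{-1/2} (1-t²)^{(d-1)/2} C_n^{d/2}(t) Y(ξ)`,
built from a spherical harmonic `Y` of degree `n - 2k`. -/
def gkjBasis (d n : ℕ) (Y : Esp d → ℝ) (ξ : Esp d) (t : ℝ) : ℝ :=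
  (Real.sqrt (hGegen ((d : ℝ) / 2) n))⁻¹ * (1 - t ^ 2) ^ (((d : ℝ) - 1) / 2) *
    gegen ((d : ℝ) / 2) n t * Y ξ

/-- `P : ℝ^d → ℝ` is (the evaluation of) a polynomial of total degree at most `n`. -/
def IsPolyDeg (d n : ℕ) (P : Esp d → ℝ) : Prop :=
  ∃ p : MvPolynomial (Fin d) ℝ, p.totalDegree ≤ n ∧
    ∀ x : Esp d, P x = MvPolynomial.eval (fun i => x i) p

/-- `P ∈ V_n^d`: `P` is a polynomial of degree at most `n` which is orthogonal, in
`L²(B^d, dx)`, to all polynomials of total degree `< n`. -/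
def MemV (d n : ℕ) (P : Esp d → ℝ) : Prop :=
  IsPolyDeg d n P ∧
    ∀ Q : Esp d → ℝ,
      (∃ q : MvPolynomial (Fin d) ℝ, q.totalDegree < n ∧
          ∀ x : Esp d, Q x = MvPolynomial.eval (fun i => x i) q) →
      ∫ x in Metric.closedBall (0 : Esp d) 1, P x * Q x = 0

/-- `p = proj_n f`, the orthogonal projection of `f` onto `V_n^d` in
`L²(B^d, b_d^{-1} dx)`: `p ∈ V_n^d` and `f - p ⟂ V_n^d`. -/
def IsProjOn (d n : ℕ) (f p : Esp d → ℝ) : Prop :=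
  MemV d n p ∧ ∀ Q : Esp d → ℝ, MemV d n Q →
    ∫ x in Metric.closedBall (0 : Esp d) 1, (f x - p x) * Q x = 0

/-- `P` is harmonic: its Laplacian vanishes identically. -/
def IsHarmonicFn {d : ℕ} (P : Esp d → ℝ) : Prop :=
  ∀ x : Esp d, ∑ i : Fin d,
    iteratedFDeriv ℝ 2 P x ![EuclideanSpace.single i 1, EuclideanSpace.single i 1] = 0

/-- `P` is homogeneous of degree `m`. -/
def IsHomogeneousDeg {d : ℕ} (m : ℕ) (P : Esp d → ℝ) : Prop :=
  ∀ (c : ℝ) (x : Esp d), P (c • x) = c ^ m * P x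

/-- `Y` is a (solid) spherical harmonic of degree `m`: a harmonic homogeneous
polynomial of degree `m`. -/
def IsSphHarm (d m : ℕ) (Y : Esp d → ℝ) : Prop :=
  IsPolyDeg d m Y ∧ IsHomogeneousDeg m Y ∧ IsHarmonicFn Y

/-- The inner product of `L²(Z, w^{1-d})`, `Z = S^{d-1} × [-1,1]`:
`⟨F,G⟩ = c_{d/2} ∫_{-1}^1 σ_d^{-1} ∫_{S^{d-1}} F(ξ,t) G(ξ,t) dω(ξ) (1-t²)^{(1-d)/2} dt`. -/
def innerZ (d : ℕ) (F G : Esp d → ℝ → ℝ) : ℝ :=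
  cConst ((d : ℝ) / 2) * ∫ t in (-1 : ℝ)..1,
    ((sigmaConst d)⁻¹ * ∫ ξ : Metric.sphere (0 : Esp d) 1, F ξ t * G ξ t ∂(sphereMeasure d)) *
      (1 - t ^ 2) ^ ((1 - (d : ℝ)) / 2)

/-- The inner product of `L²(B^d, b_d^{-1} dx)`. -/
def innerB (d : ℕ) (f g : Esp d → ℝ) : ℝ :=
  (ballVol d)⁻¹ * ∫ x in Metric.closedBall (0 : Esp d) 1, f x * g x

/-- The singular values `γ_n = b_{d-1} √(n!/(d)_n)` of the Radon transform. -/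
def svGamma (d n : ℕ) : ℝ := ballVol (d - 1) * Real.sqrt (n.factorial / poch (d : ℝ) n)

/-- The Chebyshev polynomial of the second kind `U_k`. -/
def chebU (k : ℕ) (t : ℝ) : ℝ := (Polynomial.Chebyshev.U ℝ (k : ℤ)).eval t

/-- The kernel `Φ_n(t,u) = Σ_{k=0}^n (k+1) U_k(t) U_k(u)` (the case `d = 2` of `Φ_n`). -/
def PhiU (n : ℕ) (t u : ℝ) : ℝ :=
  ∑ k ∈ Finset.range (n + 1), ((k : ℝ) + 1) * chebU k t * chebU k u

/-- The point `(cos θ, sin θ)` on the unit circle `S¹ ⊆ ℝ²`. -/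
def circlePt (θ : ℝ) : Esp 2 := (WithLp.equiv 2 (Fin 2 → ℝ)).symm ![Real.cos θ, Real.sin θ]

end

theorem integral_homogeneous_mul_radial {d : ℕ} (hd : 1 ≤ d) {h : Esp d → ℝ} {k : ℕ}
    (hh : ∀ (r : ℝ) (x : Esp d), h (r • x) = r ^ k * h x) (w : ℝ → ℝ) :
    ∫ x : Esp d, h x * w ‖x‖ =
      (∫ ξ : Metric.sphere (0 : Esp d) 1, h ξ ∂(sphereMeasure d)) *
        ∫ r in Set.Ioi (0 : ℝ), r ^ (d - 1 + k) * w r := by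
  have : Nonempty (Fin d) := ⟨⟨0, hd⟩⟩
  have hdim : Module.finrank ℝ (Esp d) = d := by simp
  calc
    ∫ x : Esp d, h x * w ‖x‖
      = ∫ x : ({(0 : Esp d)}ᶜ : Set (Esp d)), h x.1 * w ‖x.1‖
          ∂((volume : Measure (Esp d)).comap (↑)) := by
        rw [integral_subtype_comap (measurableSet_singleton _).compl
          fun x : Esp d ↦ h x * w ‖x‖, restrict_compl_singleton]
    _ = ∫ p : Metric.sphere (0 : Esp d) 1 × Set.Ioi (0 : ℝ),
          h p.1 * ((p.2 : ℝ) ^ k * w p.2)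
            ∂(volume : Measure (Esp d)).toSphere.prod (.volumeIoiPow (d - 1)) := by
        have := (volume : Measure (Esp d)).measurePreserving_homeomorphUnitSphereProd.integral_comp
          (Homeomorph.measurableEmbedding _)
          (fun p : Metric.sphere (0 : Esp d) 1 × Set.Ioi (0 : ℝ) ↦
            h p.1 * ((p.2 : ℝ) ^ k * w p.2))
        rw [hdim] at this
        rw [← this]
        refine integral_congr_ae (.of_forall fun x ↦ ?_)
        have hx : ‖(x : Esp d)‖ ≠ 0 := norm_ne_zero_iff.2 x.2
        simp only [homeomorphUnitSphereProd_apply_fst_coe, homeomorphUnitSphereProd_apply_snd_coe,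
          hh]
        rw [inv_pow]
        field_simp
    _ = (∫ ξ : Metric.sphere (0 : Esp d) 1, h ξ ∂(sphereMeasure d)) *
          ∫ r : Set.Ioi (0 : ℝ), (r : ℝ) ^ k * w r ∂(.volumeIoiPow (d - 1)) :=
        integral_prod_mul (fun ξ : Metric.sphere (0 : Esp d) 1 ↦ h ξ)
          (fun r : Set.Ioi (0 : ℝ) ↦ (r : ℝ) ^ k * w r)
    _ = _ := by
        congr 1
        simp only [Measure.volumeIoiPow, ENNReal.ofReal]
        rw [integral_withDensity_eq_integral_smul,
          integral_subtype_comap measurableSet_Ioi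
            fun a ↦ Real.toNNReal (a ^ (d - 1)) • (a ^ k * w a),
          setIntegral_congr_fun measurableSet_Ioi fun x hx ↦ ?_]
        · simp only [NNReal.smul_def, Real.coe_toNNReal _ (pow_nonneg (Set.mem_Ioi.1 hx).le _),
            smul_eq_mul]
          ring
        · exact (measurable_subtype_coe.pow_const _).real_toNNReal

theorem integral_closedBall_of_homogeneous {d : ℕ} (hd : 1 ≤ d) {h : Esp d → ℝ} {k : ℕ}
    (hh : ∀ (r : ℝ) (x : Esp d), h (r • x) = r ^ k * h x) :
    ∫ x in Metric.closedBall (0 : Esp d) 1, h x =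
      (∫ ξ : Metric.sphere (0 : Esp d) 1, h ξ ∂(sphereMeasure d)) * ((d : ℝ) + k)⁻¹ := by
  have hr : ∫ r in Set.Ioi (0 : ℝ), r ^ (d - 1 + k) * (Set.Iic (1 : ℝ)).indicator 1 r =
      ((d : ℝ) + k)⁻¹ := by
    have : (fun r : ℝ ↦ r ^ (d - 1 + k) * (Set.Iic (1 : ℝ)).indicator 1 r) =
        (Set.Iic (1 : ℝ)).indicator fun r ↦ r ^ (d - 1 + k) := by
      ext r
      by_cases hr : r ∈ Set.Iic (1 : ℝ) <;> simp [hr]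
    rw [this, setIntegral_indicator measurableSet_Iic, Set.Ioi_inter_Iic,
      ← intervalIntegral.integral_of_le zero_le_one, integral_pow]
    have : ((d - 1 + k : ℕ) : ℝ) + 1 = d + k := by
      rw [Nat.cast_add, Nat.cast_sub hd]; push_cast; ring
    rw [this]
    simp
  rw [← hr, ← integral_homogeneous_mul_radial hd hh, ← integral_indicator
    Metric.isClosed_closedBall.measurableSet]
  congr 1
  ext x
  by_cases hx : ‖x‖ ≤ 1 <;> simp [Set.indicator, hx]

theorem integral_rpow_gaussian_Ioi (m : ℕ) :
    ∫ r in Set.Ioi (0 : ℝ), r ^ m * Real.exp (-r ^ 2) = Real.Gamma (((m : ℝ) + 1) / 2) / 2 := by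
  have := integral_rpow_mul_exp_neg_rpow (p := 2) (q := m) two_pos (by
    have : (0 : ℝ) ≤ m := m.cast_nonneg
    linarith)
  simp only [Real.rpow_natCast, Real.rpow_ofNat] at this
  rw [this]
  ring

theorem integral_pow_two_mul_gaussian (N : ℕ) :
    ∫ t : ℝ, t ^ (2 * N) * Real.exp (-t ^ 2) = Real.Gamma (N + 1 / 2) := by
  have := integral_comp_abs (f := fun t : ℝ ↦ t ^ (2 * N) * Real.exp (-t ^ 2))
  simp only [sq_abs, pow_mul] at this ⊢
  simp only [← pow_mul] at this ⊢
  rw [this, integral_rpow_gaussian_Ioi]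
  push_cast
  rw [show ((2 : ℝ) * N + 1) / 2 = N + 1 / 2 by ring]
  ring

theorem integral_inner_pow_mul_gaussian {d : ℕ} (hd : 1 ≤ d) {v : Esp d} (hv : ‖v‖ = 1) (N : ℕ) :
    ∫ x : Esp d, ⟪x, v⟫ ^ (2 * N) * Real.exp (-‖x‖ ^ 2) =
      Real.Gamma (N + 1 / 2) * √π ^ (d - 1) := by
  let i₀ : Fin d := ⟨0, hd⟩
  obtain ⟨b, hb⟩ := Orthonormal.exists_orthonormalBasis_extension_of_card_eq (𝕜 := ℝ)
    (E := Esp d) (ι := Fin d) (by simp) (v := fun _ ↦ v) (s := {i₀}) (by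
      rw [orthonormal_iff_ite]
      rintro ⟨i, rfl⟩ ⟨j, rfl⟩
      simp [hv])
  have hbv : b i₀ = v := hb i₀ rfl
  have h1 : ∫ x : Esp d, ⟪x, v⟫ ^ (2 * N) * Real.exp (-‖x‖ ^ 2) =
      ∫ y : Esp d, y i₀ ^ (2 * N) * Real.exp (-‖y‖ ^ 2) := by
    rw [← b.repr.measurePreserving.integral_comp b.repr.toHomeomorph.measurableEmbedding
      fun y : Esp d ↦ y i₀ ^ (2 * N) * Real.exp (-‖y‖ ^ 2)]
    simp [b.repr_apply_apply, hbv, real_inner_comm]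
  rw [h1, ← (PiLp.volume_preserving_toLp (Fin d)).integral_comp
    (MeasurableEquiv.toLp 2 (Fin d → ℝ)).measurableEmbedding]
  have h2 (y : Fin d → ℝ) : y i₀ ^ (2 * N) *
      Real.exp (-‖(WithLp.toLp 2 y : Esp d)‖ ^ 2) =
      ∏ i, (if i = i₀ then y i ^ (2 * N) else 1) * Real.exp (-y i ^ 2) := by
    rw [Finset.prod_mul_distrib, ← Real.exp_sum, EuclideanSpace.norm_sq_eq]
    simp
  refine (integral_congr_ae (.of_forall h2)).trans ?_
  rw [integral_fintype_prod_volume_eq_prod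
    (fun i (t : ℝ) ↦ (if i = i₀ then t ^ (2 * N) else 1) * Real.exp (-t ^ 2)),
    ← Finset.mul_prod_erase _ _ (Finset.mem_univ i₀)]
  have h3 : ∀ i ∈ Finset.univ.erase i₀,
      ∫ t : ℝ, (if i = i₀ then t ^ (2 * N) else 1) * Real.exp (-t ^ 2) = √π := by
    intro i hi
    have := integral_gaussian 1
    simpa [Finset.ne_of_mem_erase hi] using this
  rw [Finset.prod_congr rfl h3]
  simp [integral_pow_two_mul_gaussian]

theorem sigmaConst_pos {d : ℕ} (hd : 1 ≤ d) : 0 < sigmaConst d := by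
  have : (0 : ℝ) < d := by exact_mod_cast hd
  have := Real.Gamma_pos_of_pos (s := (d : ℝ) / 2) (by positivity)
  unfold sigmaConst
  positivity

theorem integral_sphere_inner_pow {d : ℕ} (hd : 1 ≤ d) {v : Esp d} (hv : ‖v‖ = 1) (N : ℕ) :
    ∫ ξ : Metric.sphere (0 : Esp d) 1, ⟪(ξ : Esp d), v⟫ ^ (2 * N) ∂(sphereMeasure d) =
      sigmaConst d * Real.Gamma ((d : ℝ) / 2) * (2 * N).factorial /
        (4 ^ N * N.factorial * Real.Gamma ((d : ℝ) / 2 + N)) := by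
  have hd0 : (0 : ℝ) < d := by exact_mod_cast hd
  have h := integral_homogeneous_mul_radial hd (h := fun x : Esp d ↦ ⟪x, v⟫ ^ (2 * N))
    (k := 2 * N) (fun r x ↦ by rw [real_inner_smul_left, mul_pow]) (fun r ↦ Real.exp (-r ^ 2))
  rw [integral_inner_pow_mul_gaussian hd hv, integral_rpow_gaussian_Ioi] at h
  have hc : (((d - 1 + 2 * N : ℕ) : ℝ) + 1) / 2 = d / 2 + N := by
    rw [Nat.cast_add, Nat.cast_sub hd]; push_cast; ring
  have hG : Real.Gamma (N + 1 / 2) = (2 * N).factorial * √π / (4 ^ N * N.factorial) := by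
    have h4 : (4 : ℝ) ^ N = 2 ^ N * 2 ^ N := by rw [← mul_pow]; norm_num
    cases N with
    | zero => simpa using Real.Gamma_one_half_eq
    | succ N =>
      have e1 := Nat.factorial_eq_mul_doubleFactorial (2 * N + 1)
      have e2 := Nat.doubleFactorial_two_mul (N + 1)
      rw [show 2 * (N + 1) = 2 * N + 1 + 1 by ring] at e2 ⊢
      rw [Nat.cast_add_one, Real.Gamma_nat_add_one_add_half, h4, e1, e2]
      push_cast
      field_simp
  have hp : √π ^ (d - 1) * √π = π ^ ((d : ℝ) / 2) := by
    rw [← pow_succ, Nat.sub_add_cancel hd, Real.sqrt_eq_rpow, ← Real.rpow_natCast,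
      ← Real.rpow_mul pi_pos.le]
    ring_nf
  have h1 := Real.Gamma_pos_of_pos (s := (d : ℝ) / 2) (by positivity)
  have h2 := Real.Gamma_pos_of_pos (s := (d : ℝ) / 2 + N) (by positivity)
  rw [hc, hG] at h
  unfold sigmaConst
  rw [← hp]
  field_simp at h ⊢
  linear_combination -h

theorem exists_norm_eq_one_and_eq_norm_smul {d : ℕ} (hd : 1 ≤ d) (v : Esp d) :
    ∃ u : Esp d, ‖u‖ = 1 ∧ v = ‖v‖ • u := by
  by_cases hv : v = 0
  · exact ⟨EuclideanSpace.single ⟨0, hd⟩ 1, by simp, by simp [hv]⟩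
  · have hv' : ‖v‖ ≠ 0 := norm_ne_zero_iff.2 hv
    exact ⟨‖v‖⁻¹ • v, by simp [norm_smul, hv'], by simp [smul_smul, hv']⟩

instance isFiniteMeasure_sphereMeasure (d : ℕ) : IsFiniteMeasure (sphereMeasure d) :=
  inferInstanceAs (IsFiniteMeasure (volume : Measure (Esp d)).toSphere)

theorem Continuous.integrable_sphereMeasure {d : ℕ} {f : Metric.sphere (0 : Esp d) 1 → ℝ}
    (hf : Continuous f) : Integrable f (sphereMeasure d) :=
  hf.integrable_of_hasCompactSupport (HasCompactSupport.of_compactSpace f)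

/-- The integral of `⟪ξ, v⟫ ^ (2 * N)` over the unit sphere, for a unit vector `v`. -/
noncomputable def sphereMoment (d N : ℕ) : ℝ :=
  sigmaConst d * Real.Gamma ((d : ℝ) / 2) * (2 * N).factorial /
    (4 ^ N * N.factorial * Real.Gamma ((d : ℝ) / 2 + N))

theorem integral_sphere_inner_pow' {d : ℕ} (hd : 1 ≤ d) (v : Esp d) (N : ℕ) :
    ∫ ξ : Metric.sphere (0 : Esp d) 1, ⟪(ξ : Esp d), v⟫ ^ (2 * N) ∂(sphereMeasure d) =
      sphereMoment d N * (‖v‖ ^ 2) ^ N := by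
  obtain ⟨u, hu, huv⟩ := exists_norm_eq_one_and_eq_norm_smul hd v
  have h (ξ : Esp d) : ⟪ξ, v⟫ ^ (2 * N) = ‖v‖ ^ (2 * N) * ⟪ξ, u⟫ ^ (2 * N) := by
    conv_lhs => rw [huv, real_inner_smul_right, mul_pow]
  simp only [h]
  rw [integral_const_mul, integral_sphere_inner_pow hd hu, pow_mul, mul_comm]
  rfl

open Polynomial in
theorem coeff_one_add_mul_X_add_mul_X_sq_pow (b c : ℝ) (N q : ℕ) :
    ((1 + C b * X + C c * X ^ 2 : ℝ[X]) ^ N).coeff q =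
      ∑ j ∈ Finset.range (q / 2 + 1),
        (N.choose j * (N - j).choose (q - 2 * j) : ℝ) * b ^ (q - 2 * j) * c ^ j := by
  have hlin (M i : ℕ) : ((1 + C b * X : ℝ[X]) ^ M).coeff i = M.choose i * b ^ i := by
    have : (1 + C b * X : ℝ[X]) ^ M = ((1 + X) ^ M).comp (C b * X) := by simp
    rw [this, comp_C_mul_X_coeff, coeff_one_add_X_pow]
  have hterm (j : ℕ) : ((C c * X ^ 2) ^ j * (1 + C b * X) ^ (N - j) *
      (N.choose j : ℝ[X])).coeff q =
      if 2 * j ≤ q then (N.choose j * (N - j).choose (q - 2 * j) : ℝ) *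
        b ^ (q - 2 * j) * c ^ j else 0 := by
    have : (C c * X ^ 2) ^ j * (1 + C b * X) ^ (N - j) * (N.choose j : ℝ[X]) =
        C (c ^ j * N.choose j) * ((1 + C b * X) ^ (N - j) * X ^ (2 * j)) := by
      rw [mul_pow, ← pow_mul]
      simp
      ring
    rw [this, coeff_C_mul, coeff_mul_X_pow']
    split_ifs
    · rw [hlin]; ring
    · simp
  rw [add_comm, add_pow, finsetSum_coeff]
  simp only [hterm]
  rw [← Finset.sum_filter]
  have hsub : (Finset.range (N + 1)).filter (fun j ↦ 2 * j ≤ q) ⊆ Finset.range (q / 2 + 1) := by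
    intro j hj
    simp only [Finset.mem_filter, Finset.mem_range] at hj ⊢
    omega
  refine Finset.sum_subset hsub fun j hj hj' ↦ ?_
  simp only [Finset.mem_filter, Finset.mem_range] at hj hj'
  rw [Nat.choose_eq_zero_of_lt (by omega : N < j)]
  simp

open Polynomial in
theorem choose_mul_integral_sphere_inner_pow_mul_inner_pow {d : ℕ} (hd : 1 ≤ d) {u : Esp d}
    (hu : ‖u‖ = 1) (η : Esp d) {p q N : ℕ} (hpq : p + q = 2 * N) :
    ((2 * N).choose q : ℝ) * ∫ ξ : Metric.sphere (0 : Esp d) 1,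
        ⟪(ξ : Esp d), u⟫ ^ p * ⟪(ξ : Esp d), η⟫ ^ q ∂(sphereMeasure d) =
      sphereMoment d N * ∑ j ∈ Finset.range (q / 2 + 1),
        (N.choose j * (N - j).choose (q - 2 * j) : ℝ) * (2 * ⟪u, η⟫) ^ (q - 2 * j) *
          (‖η‖ ^ 2) ^ j := by
  let I (i : ℕ) : ℝ := ∫ ξ : Metric.sphere (0 : Esp d) 1,
    ⟪(ξ : Esp d), u⟫ ^ (2 * N - i) * ⟪(ξ : Esp d), η⟫ ^ i ∂(sphereMeasure d)
  have key : (∑ i ∈ Finset.range (2 * N + 1), C ((2 * N).choose i * I i) * X ^ i : ℝ[X]) =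
      C (sphereMoment d N) * (1 + C (2 * ⟪u, η⟫) * X + C (‖η‖ ^ 2) * X ^ 2) ^ N := by
    refine Polynomial.funext fun t ↦ ?_
    have h1 : ‖t • η + u‖ ^ 2 = 1 + 2 * ⟪u, η⟫ * t + ‖η‖ ^ 2 * t ^ 2 := by
      rw [norm_add_sq_real, norm_smul, real_inner_smul_left, hu, mul_pow, Real.norm_eq_abs,
        sq_abs, real_inner_comm]
      ring
    have h2 (ξ : Esp d) : ⟪ξ, t • η + u⟫ ^ (2 * N) = ∑ i ∈ Finset.range (2 * N + 1),
        ((2 * N).choose i * t ^ i) * (⟪ξ, u⟫ ^ (2 * N - i) * ⟪ξ, η⟫ ^ i) := by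
      rw [inner_add_right, real_inner_smul_right, add_pow]
      exact Finset.sum_congr rfl fun i _ ↦ by ring
    have h3 := integral_sphere_inner_pow' hd (t • η + u) N
    simp only [h2] at h3
    rw [integral_finsetSum _ fun i _ ↦ Continuous.integrable_sphereMeasure (by fun_prop), h1] at h3
    simp only [integral_const_mul] at h3
    simp only [eval_finsetSum, eval_mul, eval_C, eval_pow, eval_X, eval_add, eval_one]
    rw [← h3]
    exact Finset.sum_congr rfl fun i _ ↦ by ring
  have := congrArg (fun P : ℝ[X] ↦ P.coeff q) key
  simp only [finsetSum_coeff, coeff_C_mul, coeff_X_pow, mul_ite, mul_one, mul_zero] at this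
  rw [coeff_one_add_mul_X_add_mul_X_sq_pow, Finset.sum_ite_eq,
    if_pos (Finset.mem_range.2 (by omega))] at this
  rw [← this]
  simp only [I]
  rw [show 2 * N - q = p by omega]

theorem sum_range_succ_neg_one_pow_mul_choose_succ (g : ℕ → ℝ) (N : ℕ) :
    ∑ k ∈ Finset.range (N + 2), (-1 : ℝ) ^ k * (N + 1).choose k * g k =
      ∑ k ∈ Finset.range (N + 1), (-1 : ℝ) ^ k * N.choose k * g k -
        ∑ k ∈ Finset.range (N + 1), (-1 : ℝ) ^ k * N.choose k * g (k + 1) := by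
  have h : ∑ k ∈ Finset.range (N + 1), (-1 : ℝ) ^ k * N.choose k * g k =
      ∑ k ∈ Finset.range (N + 2), (-1 : ℝ) ^ k * N.choose k * g k := by
    rw [Finset.sum_range_succ _ (N + 1)]
    simp
  rw [h, Finset.sum_range_succ', Finset.sum_range_succ' _ (N + 1), add_sub_right_comm,
    ← Finset.sum_sub_distrib]
  congr 1
  · refine Finset.sum_congr rfl fun k _ ↦ ?_
    rw [Nat.choose_succ_succ]
    push_cast
    ring
  · simp

theorem sum_neg_one_pow_mul_choose_mul_Gamma_div_Gamma (s : ℝ) (N : ℕ) :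
    ∀ z : ℝ, 0 < z - N → 0 < z - N - s →
      ∑ k ∈ Finset.range (N + 1),
        (-1 : ℝ) ^ k * N.choose k * (Real.Gamma (z - k) / Real.Gamma (z - k - s)) =
      (∏ i ∈ Finset.range N, (s - i)) * (Real.Gamma (z - N) / Real.Gamma (z - s)) := by
  induction N with
  | zero => simp
  | succ N ih =>
    intro z h1 h2
    push_cast at h1 h2
    have hN : (0 : ℝ) ≤ N := N.cast_nonneg
    have e (k : ℕ) : z - (k + 1 : ℕ) = z - 1 - k := by push_cast; ring
    rw [sum_range_succ_neg_one_pow_mul_choose_succ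
      (fun k ↦ Real.Gamma (z - k) / Real.Gamma (z - k - s)) N, ih z (by linarith) (by linarith)]
    simp only [e]
    rw [ih (z - 1) (by linarith) (by linarith), Finset.prod_range_succ]
    have g1 : Real.Gamma (z - N) = (z - 1 - N) * Real.Gamma (z - 1 - N) := by
      rw [← Real.Gamma_add_one (by linarith)]; congr 1; ring
    have g2 : Real.Gamma (z - s) = (z - 1 - s) * Real.Gamma (z - 1 - s) := by
      rw [← Real.Gamma_add_one (by linarith)]; congr 1; ring
    have g3 := Real.Gamma_pos_of_pos (s := z - 1 - s) (by linarith)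
    have g4 : 0 < z - 1 - s := by linarith
    rw [g1, g2]
    field_simp
    ring

/-- The coefficient of `t ^ (n - 2 * k)` in `gegen lam n t`. -/
noncomputable def gegenCoeff (lam : ℝ) (n k : ℕ) : ℝ :=
  (-1 : ℝ) ^ k * Real.Gamma ((n : ℝ) - k + lam) /
    (Real.Gamma lam * (Nat.factorial k) * (Nat.factorial (n - 2 * k))) * 2 ^ (n - 2 * k)

theorem gegen_eq_sum (lam : ℝ) (n : ℕ) (t : ℝ) :
    gegen lam n t =
      ∑ k ∈ Finset.range (n / 2 + 1), gegenCoeff lam n k * t ^ (n - 2 * k) := by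
  simp only [gegen, gegenCoeff, mul_pow]
  exact Finset.sum_congr rfl fun k _ ↦ by ring

@[fun_prop]
theorem continuous_gegen (lam : ℝ) (n : ℕ) : Continuous (gegen lam n) := by
  unfold gegen
  fun_prop

theorem inv_factorial_mul_choose_mul_choose {m r j k N : ℕ} (hN : N + k = m + r)
    (hj : 2 * j ≤ m) :
    ((N.factorial : ℝ))⁻¹ * (N.choose j * (N - j).choose (m - 2 * j)) =
      (r + j).choose k * k.factorial /
        ((m - 2 * j).factorial * j.factorial * (r + j).factorial) := by
  by_cases hk : k ≤ r + j
  · rw [Nat.cast_choose ℝ (by omega : j ≤ N), Nat.cast_choose ℝ (by omega : m - 2 * j ≤ N - j),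
      Nat.cast_choose ℝ hk, show N - j - (m - 2 * j) = r + j - k by omega]
    have h1 := Nat.factorial_pos N
    have h2 := Nat.factorial_pos (N - j)
    field_simp
  · rw [Nat.choose_eq_zero_of_lt (by omega : r + j < k)]
    by_cases hjN : j ≤ N
    · rw [Nat.choose_eq_zero_of_lt (by omega : N - j < m - 2 * j)]
      simp
    · rw [Nat.choose_eq_zero_of_lt (by omega : N < j)]
      simp

theorem gegenCoeff_mul_integral_sphere {d : ℕ} (hd : 1 ≤ d) {u : Esp d} (hu : ‖u‖ = 1)
    (η : Esp d) {n m r k : ℕ} (hn : n = m + 2 * r) (hk : 2 * k ≤ n) :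
    gegenCoeff ((d : ℝ) / 2) n k * ∫ ξ : Metric.sphere (0 : Esp d) 1,
        ⟪(ξ : Esp d), u⟫ ^ (n - 2 * k) * ⟪(ξ : Esp d), η⟫ ^ m ∂(sphereMeasure d) =
      sigmaConst d * m.factorial / 2 ^ m * ∑ j ∈ Finset.range (m / 2 + 1),
        (2 * ⟪u, η⟫) ^ (m - 2 * j) * (‖η‖ ^ 2) ^ j /
            ((m - 2 * j).factorial * j.factorial * (r + j).factorial) *
          ((-1) ^ k * (r + j).choose k *
            (Real.Gamma (n + (d : ℝ) / 2 - k) / Real.Gamma (n + (d : ℝ) / 2 - k - r))) := by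
  have hd0 : (0 : ℝ) < d := by exact_mod_cast hd
  obtain ⟨N, hN⟩ : ∃ N, N + k = m + r := ⟨m + r - k, by omega⟩
  have hpq : n - 2 * k + m = 2 * N := by omega
  have hI := choose_mul_integral_sphere_inner_pow_mul_inner_pow hd hu η hpq
  rw [Nat.cast_choose ℝ (by omega : m ≤ 2 * N), show 2 * N - m = n - 2 * k by omega] at hI
  set I := ∫ ξ : Metric.sphere (0 : Esp d) 1,
    ⟪(ξ : Esp d), u⟫ ^ (n - 2 * k) * ⟪(ξ : Esp d), η⟫ ^ m ∂(sphereMeasure d)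
  have hNr : (N : ℝ) + k = m + r := by exact_mod_cast hN
  have hnr : (n : ℝ) = m + 2 * r := by exact_mod_cast hn
  have hz : (n : ℝ) + (d : ℝ) / 2 - k - r = (d : ℝ) / 2 + N := by linarith
  have hz' : (n : ℝ) - k + (d : ℝ) / 2 = n + (d : ℝ) / 2 - k := by ring
  have h1 := Real.Gamma_pos_of_pos (s := (d : ℝ) / 2) (by positivity)
  have h2 := Real.Gamma_pos_of_pos (s := (d : ℝ) / 2 + N) (by positivity)
  have h4 : (4 : ℝ) ^ N = 2 ^ (n - 2 * k) * 2 ^ m := by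
    rw [← pow_add, hpq, pow_mul]; norm_num
  have hI' : I = sigmaConst d * Real.Gamma ((d : ℝ) / 2) * m.factorial * (n - 2 * k).factorial /
      (4 ^ N * Real.Gamma ((d : ℝ) / 2 + N)) * ∑ j ∈ Finset.range (m / 2 + 1),
        (2 * ⟪u, η⟫) ^ (m - 2 * j) * (‖η‖ ^ 2) ^ j * (((N.factorial : ℝ))⁻¹ *
          (N.choose j * (N - j).choose (m - 2 * j))) := by
    have hs : ∑ j ∈ Finset.range (m / 2 + 1),
        (2 * ⟪u, η⟫) ^ (m - 2 * j) * (‖η‖ ^ 2) ^ j * (((N.factorial : ℝ))⁻¹ *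
          (N.choose j * (N - j).choose (m - 2 * j))) = ((N.factorial : ℝ))⁻¹ *
        ∑ j ∈ Finset.range (m / 2 + 1),
        (N.choose j * (N - j).choose (m - 2 * j) : ℝ) * (2 * ⟪u, η⟫) ^ (m - 2 * j) *
          (‖η‖ ^ 2) ^ j := by
      rw [Finset.mul_sum]
      exact Finset.sum_congr rfl fun j _ ↦ by ring
    rw [hs]
    unfold sphereMoment at hI
    have h3 := Nat.factorial_pos (2 * N)
    field_simp at hI ⊢
    linear_combination hI
  rw [hI', gegenCoeff, hz, hz', h4, Finset.mul_sum, Finset.mul_sum, Finset.mul_sum]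
  refine Finset.sum_congr rfl fun j hj ↦ ?_
  rw [inv_factorial_mul_choose_mul_choose hN (by have := Finset.mem_range.1 hj; omega)]
  field_simp

theorem sum_gegenCoeff_mul_integral_sphere {d : ℕ} (hd : 1 ≤ d) {u : Esp d} (hu : ‖u‖ = 1)
    (η : Esp d) {n m r : ℕ} (hn : n = m + 2 * r) (w : ℕ → ℝ) :
    ∑ k ∈ Finset.range (n / 2 + 1), gegenCoeff ((d : ℝ) / 2) n k *
        (∫ ξ : Metric.sphere (0 : Esp d) 1,
          ⟪(ξ : Esp d), u⟫ ^ (n - 2 * k) * ⟪(ξ : Esp d), η⟫ ^ m ∂(sphereMeasure d)) * w k =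
      sigmaConst d * m.factorial / 2 ^ m * ∑ j ∈ Finset.range (m / 2 + 1),
        (2 * ⟪u, η⟫) ^ (m - 2 * j) * (‖η‖ ^ 2) ^ j /
            ((m - 2 * j).factorial * j.factorial * (r + j).factorial) *
          ∑ k ∈ Finset.range (r + j + 1), (-1) ^ k * (r + j).choose k *
            (Real.Gamma (n + (d : ℝ) / 2 - k) / Real.Gamma (n + (d : ℝ) / 2 - k - r) * w k) := by
  have hext (j : ℕ) (hj : j ∈ Finset.range (m / 2 + 1)) :
      ∑ k ∈ Finset.range (r + j + 1), (-1) ^ k * (r + j).choose k *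
        (Real.Gamma (n + (d : ℝ) / 2 - k) / Real.Gamma (n + (d : ℝ) / 2 - k - r) * w k) =
      ∑ k ∈ Finset.range (n / 2 + 1), (-1) ^ k * (r + j).choose k *
        (Real.Gamma (n + (d : ℝ) / 2 - k) / Real.Gamma (n + (d : ℝ) / 2 - k - r) * w k) := by
    have hj := Finset.mem_range.1 hj
    refine Finset.sum_subset (Finset.range_subset_range.2 (by omega)) fun k _ hk ↦ ?_
    rw [Nat.choose_eq_zero_of_lt (by simpa [Nat.lt_succ_iff] using hk)]
    simp
  rw [Finset.sum_congr rfl fun k hk ↦ congrArg (· * w k)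
      (gegenCoeff_mul_integral_sphere hd hu η hn (by have := Finset.mem_range.1 hk; omega)),
    Finset.sum_congr (s₁ := Finset.range (m / 2 + 1)) rfl
      fun j hj ↦ congrArg (_ * ·) (hext j hj)]
  simp only [Finset.mul_sum, Finset.sum_mul]
  rw [Finset.sum_comm]
  exact Finset.sum_congr rfl fun j _ ↦ Finset.sum_congr rfl fun k _ ↦ by ring

theorem Continuous.integrableOn_closedBall {d : ℕ} {f : Esp d → ℝ} (hf : Continuous f)
    (c : Esp d) (R : ℝ) : IntegrableOn f (Metric.closedBall c R) :=
  hf.continuousOn.integrableOn_compact (isCompact_closedBall c R)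

theorem integral_sphere_gegen_mul_inner_pow {d : ℕ} (hd : 1 ≤ d) {u : Esp d} (hu : ‖u‖ = 1)
    (η : Esp d) {n m r : ℕ} (hn : n = m + 2 * r) :
    ∫ ξ : Metric.sphere (0 : Esp d) 1,
        gegen ((d : ℝ) / 2) n ⟪(ξ : Esp d), u⟫ * ⟪(ξ : Esp d), η⟫ ^ m ∂(sphereMeasure d) =
      sigmaConst d * ⟪u, η⟫ ^ m := by
  have hd0 : (0 : ℝ) < d := by exact_mod_cast hd
  have hm0 : (0 : ℝ) ≤ m := m.cast_nonneg
  have hr0 : (0 : ℝ) ≤ r := r.cast_nonneg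
  have hnr : (n : ℝ) = m + 2 * r := by exact_mod_cast hn
  have hfd (j : ℕ) (hj : 2 * j ≤ m) := by
    have hjr : (2 * j : ℝ) ≤ m := by exact_mod_cast hj
    have hj0 : (0 : ℝ) ≤ j := j.cast_nonneg
    exact sum_neg_one_pow_mul_choose_mul_Gamma_div_Gamma r (r + j) ((n : ℝ) + (d : ℝ) / 2)
      (by rw [hnr]; push_cast; linarith) (by rw [hnr]; push_cast; linarith)
  simp only [gegen_eq_sum, Finset.sum_mul]
  rw [integral_finsetSum _ fun i _ ↦ Continuous.integrable_sphereMeasure (by fun_prop)]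
  simp only [mul_assoc, integral_const_mul]
  have := sum_gegenCoeff_mul_integral_sphere hd hu η hn (fun _ ↦ 1)
  simp only [mul_one] at this
  rw [this, Finset.sum_eq_single 0]
  · have hp : ∏ i ∈ Finset.range r, ((r : ℝ) - i) = r.factorial := by
      rw [← Nat.descFactorial_self, Nat.descFactorial_eq_prod_range, Nat.cast_prod]
      exact Finset.prod_congr rfl fun i hi ↦ (Nat.cast_sub (Finset.mem_range.1 hi).le).symm
    have hG := Real.Gamma_pos_of_pos (s := (n : ℝ) + d / 2 - r) (by rw [hnr]; linarith)
    rw [hfd 0 (by omega)]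
    simp only [add_zero, hp, mul_zero, Nat.sub_zero, pow_zero, mul_one, Nat.factorial_zero,
      Nat.cast_one, div_self hG.ne', mul_pow]
    field_simp
  · intro j hj hj0
    have hj := Finset.mem_range.1 hj
    rw [hfd j (by omega),
      Finset.prod_eq_zero (Finset.mem_range.2 (by omega : r < r + j)) (sub_self _)]
    simp
  · simp

theorem integral_closedBall_gegen_mul_inner_pow {d : ℕ} (hd : 1 ≤ d) {u : Esp d} (hu : ‖u‖ = 1)
    (η : Esp d) {n m r : ℕ} (hn : n = m + 2 * r) :
    ∫ x in Metric.closedBall (0 : Esp d) 1, gegen ((d : ℝ) / 2) n ⟪x, u⟫ * ⟪x, η⟫ ^ m =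
      sigmaConst d * m.factorial / 2 ^ m * ∑ j ∈ Finset.range (m / 2 + 1),
        (2 * ⟪u, η⟫) ^ (m - 2 * j) * (‖η‖ ^ 2) ^ j /
            ((m - 2 * j).factorial * j.factorial * (r + j).factorial) *
          (2⁻¹ * ((∏ i ∈ Finset.range (r + j), ((r : ℝ) - 1 - i)) *
            (Real.Gamma (n + (d : ℝ) / 2 - (r + j)) / Real.Gamma (n + (d : ℝ) / 2 - (r - 1))))) := by
  have hd0 : (0 : ℝ) < d := by exact_mod_cast hd
  have hm0 : (0 : ℝ) ≤ m := m.cast_nonneg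
  have hr0 : (0 : ℝ) ≤ r := r.cast_nonneg
  have hnr : (n : ℝ) = m + 2 * r := by exact_mod_cast hn
  have hint (k : ℕ) : ∫ x in Metric.closedBall (0 : Esp d) 1, ⟪x, u⟫ ^ (n - 2 * k) * ⟪x, η⟫ ^ m =
      (∫ ξ : Metric.sphere (0 : Esp d) 1,
        ⟪(ξ : Esp d), u⟫ ^ (n - 2 * k) * ⟪(ξ : Esp d), η⟫ ^ m ∂(sphereMeasure d)) *
        ((d : ℝ) + (n - 2 * k + m : ℕ))⁻¹ :=
    integral_closedBall_of_homogeneous hd fun c x ↦ by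
      simp only [real_inner_smul_left]
      ring
  simp only [gegen_eq_sum, Finset.sum_mul]
  rw [integral_finsetSum _ fun i _ ↦ (Continuous.integrableOn_closedBall (by fun_prop) _ _)]
  conv_lhs =>
    simp only [mul_assoc, integral_const_mul, hint]
    simp only [← mul_assoc]
  rw [sum_gegenCoeff_mul_integral_sphere hd hu η hn]
  congr 1
  refine Finset.sum_congr rfl fun j hj ↦ ?_
  have hj := Finset.mem_range.1 hj
  have hjr : (2 * j : ℝ) ≤ m := by exact_mod_cast (by omega : 2 * j ≤ m)
  have hj0 : (0 : ℝ) ≤ j := j.cast_nonneg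
  have hfd := sum_neg_one_pow_mul_choose_mul_Gamma_div_Gamma (r - 1) (r + j)
    ((n : ℝ) + (d : ℝ) / 2)
    (by rw [hnr]; push_cast; linarith) (by rw [hnr]; push_cast; linarith)
  rw [Nat.cast_add] at hfd
  rw [← hfd]
  congr 1
  rw [Finset.mul_sum]
  refine Finset.sum_congr rfl fun k hk ↦ ?_
  have hk := Finset.mem_range.1 hk
  have hkr : (k : ℝ) ≤ r + j := by exact_mod_cast (by omega : k ≤ r + j)
  have hpos : 0 < (n : ℝ) + (d : ℝ) / 2 - k - r := by rw [hnr]; linarith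
  have hG := Real.Gamma_pos_of_pos hpos
  rw [show (n : ℝ) + (d : ℝ) / 2 - k - (r - 1) = (n : ℝ) + (d : ℝ) / 2 - k - r + 1 by ring,
    Real.Gamma_add_one hpos.ne', Nat.cast_add, Nat.cast_sub (by omega),
    show (d : ℝ) + ((n : ℝ) - (2 * k : ℕ) + m) = 2 * ((n : ℝ) + (d : ℝ) / 2 - k - r) by
      rw [hnr]; push_cast; ring]
  field_simp

theorem integral_closedBall_eq_zero_of_odd {d : ℕ} {f : Esp d → ℝ} (hf : ∀ x, f (-x) = -f x) :
    ∫ x in Metric.closedBall (0 : Esp d) 1, f x = 0 := by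
  have h := (Measure.measurePreserving_neg (volume : Measure (Esp d))).setIntegral_preimage_emb
    (MeasurableEquiv.neg _).measurableEmbedding f (Metric.closedBall 0 1)
  rw [show Neg.neg ⁻¹' Metric.closedBall (0 : Esp d) 1 = Metric.closedBall 0 1 by ext; simp] at h
  simp only [hf, integral_neg] at h
  linarith

theorem integral_closedBall_gegen_mul_inner_pow_of_lt {d : ℕ} (hd : 1 ≤ d) {u : Esp d}
    (hu : ‖u‖ = 1) (η : Esp d) {n m : ℕ} (hmn : m < n) :
    ∫ x in Metric.closedBall (0 : Esp d) 1, gegen ((d : ℝ) / 2) n ⟪x, u⟫ * ⟪x, η⟫ ^ m = 0 := by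
  obtain ⟨r, hr | hr⟩ := Nat.even_or_odd' (n - m)
  · rw [integral_closedBall_gegen_mul_inner_pow hd hu η (show n = m + 2 * r by omega),
      Finset.sum_eq_zero fun j _ ↦ ?_, mul_zero]
    rw [Finset.prod_eq_zero (i := r - 1) (Finset.mem_range.2 (by omega))
      (by rw [Nat.cast_sub (by omega)]; simp)]
    simp
  · refine integral_closedBall_eq_zero_of_odd fun x ↦ ?_
    simp only [gegen_eq_sum, inner_neg_left, Finset.sum_mul, ← Finset.sum_neg_distrib]
    refine Finset.sum_congr rfl fun k hk ↦ ?_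
    have hk := Finset.mem_range.1 hk
    rw [neg_pow, neg_pow ⟪x, η⟫]
    have : (-1 : ℝ) ^ (n - 2 * k) * (-1) ^ m = -1 := by
      rw [← pow_add]
      exact Odd.neg_one_pow ⟨r + m - k, by omega⟩
    linear_combination (gegenCoeff (d / 2) n k * ⟪x, u⟫ ^ (n - 2 * k) * ⟪x, η⟫ ^ m) * this

theorem integral_closedBall_gegen_mul_inner_pow_self {d : ℕ} (hd : 1 ≤ d) {u η : Esp d}
    (hu : ‖u‖ = 1) (hη : ‖η‖ = 1) (n : ℕ) :
    gegenCoeff ((d : ℝ) / 2) n 0 *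
      ∫ x in Metric.closedBall (0 : Esp d) 1, gegen ((d : ℝ) / 2) n ⟪x, u⟫ * ⟪x, η⟫ ^ n =
      sigmaConst d / (2 * ((n : ℝ) + (d : ℝ) / 2)) * gegen ((d : ℝ) / 2) n ⟪u, η⟫ := by
  have hd0 : (0 : ℝ) < d := by exact_mod_cast hd
  have hpos : 0 < (n : ℝ) + (d : ℝ) / 2 := by positivity
  have hG := Real.Gamma_pos_of_pos hpos
  have hG' := Real.Gamma_pos_of_pos (s := (d : ℝ) / 2) (by positivity)
  rw [integral_closedBall_gegen_mul_inner_pow hd hu η (show n = n + 2 * 0 by omega), gegen, hη,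
    Finset.mul_sum, Finset.mul_sum, Finset.mul_sum]
  refine Finset.sum_congr rfl fun j hj ↦ ?_
  have hprod : ∏ i ∈ Finset.range (0 + j), (((0 : ℕ) : ℝ) - 1 - i) = (-1) ^ j * j.factorial := by
    rw [zero_add, ← Finset.prod_range_add_one_eq_factorial, Nat.cast_prod,
      ← Finset.card_range j, ← Finset.prod_const, Finset.card_range, ← Finset.prod_mul_distrib]
    exact Finset.prod_congr rfl fun i _ ↦ by push_cast; ring
  rw [hprod, gegenCoeff]
  simp only [Nat.cast_zero, zero_sub, sub_neg_eq_add, Real.Gamma_add_one hpos.ne', zero_add,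
    sub_zero, mul_zero, Nat.sub_zero, Nat.factorial_zero, Nat.cast_one, one_pow, mul_one, pow_zero,
    one_mul, show (n : ℝ) - j + (d : ℝ) / 2 = n + (d : ℝ) / 2 - j by ring]
  generalize Real.Gamma ((n : ℝ) + (d : ℝ) / 2) = G at *
  generalize Real.Gamma ((n : ℝ) + (d : ℝ) / 2 - j) = G2 at *
  generalize (n : ℝ) + (d : ℝ) / 2 = z at *
  field_simp

theorem integral_sphere_gegen_mul_gegen {d : ℕ} (hd : 1 ≤ d) {u : Esp d} (hu : ‖u‖ = 1)
    (x : Esp d) (n : ℕ) :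
    ∫ ξ : Metric.sphere (0 : Esp d) 1,
        gegen ((d : ℝ) / 2) n ⟪(ξ : Esp d), u⟫ * gegen ((d : ℝ) / 2) n ⟪(ξ : Esp d), x⟫
          ∂(sphereMeasure d) =
      sigmaConst d * gegen ((d : ℝ) / 2) n ⟪u, x⟫ := by
  conv_lhs =>
    enter [2, ξ]
    rw [gegen_eq_sum _ _ ⟪(ξ : Esp d), x⟫, Finset.mul_sum]
  rw [integral_finsetSum _ fun i _ ↦ Continuous.integrable_sphereMeasure (by fun_prop),
    gegen_eq_sum, Finset.mul_sum]
  refine Finset.sum_congr rfl fun k hk ↦ ?_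
  have hk := Finset.mem_range.1 hk
  simp only [mul_left_comm _ (gegenCoeff _ _ _), integral_const_mul]
  rw [integral_sphere_gegen_mul_inner_pow hd hu x (show n = n - 2 * k + 2 * k by omega)]

theorem inner_pow_eq_sum_piAntidiag {d : ℕ} (x y : Esp d) (m : ℕ) :
    ⟪x, y⟫ ^ m = ∑ k ∈ Finset.piAntidiag Finset.univ m,
      (Nat.multinomial Finset.univ k : ℝ) * (∏ i, x i ^ k i) * ∏ i, y i ^ k i := by
  simp only [PiLp.inner_apply, RCLike.inner_apply, conj_trivial,
    Finset.sum_pow_eq_sum_piAntidiag, mul_pow, Finset.prod_mul_distrib]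
  exact Finset.sum_congr rfl fun k _ ↦ by ring

/-- The polynomial `η ↦ ∫ g(a) ⟪φ(a), η⟫ ^ m dμ(a)`. -/
noncomputable def momentPoly {d : ℕ} {α : Type*} [MeasurableSpace α] (μ : Measure α)
    (φ : α → Esp d) (g : α → ℝ) (m : ℕ) : MvPolynomial (Fin d) ℝ :=
  ∑ k ∈ Finset.piAntidiag Finset.univ m,
    MvPolynomial.monomial (Finsupp.equivFunOnFinite.symm k)
      ((Nat.multinomial Finset.univ k : ℝ) * ∫ a, g a * ∏ i, φ a i ^ k i ∂μ)

theorem totalDegree_momentPoly_le {d : ℕ} {α : Type*} [MeasurableSpace α] (μ : Measure α)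
    (φ : α → Esp d) (g : α → ℝ) (m : ℕ) : (momentPoly μ φ g m).totalDegree ≤ m := by
  refine MvPolynomial.totalDegree_finsetSum_le fun k hk ↦
    (MvPolynomial.totalDegree_monomial_le _ _).trans ?_
  rw [Finsupp.sum_fintype _ _ fun _ ↦ rfl]
  exact (Finset.mem_piAntidiag.1 hk).1.le

theorem eval_momentPoly {d : ℕ} {α : Type*} [MeasurableSpace α] {μ : Measure α}
    {φ : α → Esp d} {g : α → ℝ} (m : ℕ)
    (hg : ∀ k : Fin d → ℕ, Integrable (fun a ↦ g a * ∏ i, φ a i ^ k i) μ) (η : Esp d) :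
    MvPolynomial.eval (fun i ↦ η i) (momentPoly μ φ g m) = ∫ a, g a * ⟪φ a, η⟫ ^ m ∂μ := by
  have h (a : α) : g a * ⟪φ a, η⟫ ^ m = ∑ k ∈ Finset.piAntidiag Finset.univ m,
      ((Nat.multinomial Finset.univ k : ℝ) * ∏ i, η i ^ k i) * (g a * ∏ i, φ a i ^ k i) := by
    rw [inner_pow_eq_sum_piAntidiag, Finset.mul_sum]
    exact Finset.sum_congr rfl fun k _ ↦ by ring
  simp only [h]
  rw [integral_finsetSum _ fun k _ ↦ (hg k).const_mul _, momentPoly, map_sum]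
  refine Finset.sum_congr rfl fun k _ ↦ ?_
  rw [integral_const_mul, MvPolynomial.eval_monomial, Finsupp.prod_fintype _ _ (by simp)]
  simp only [Finsupp.equivFunOnFinite_symm_apply_apply]
  ring

theorem coeff_momentPoly {d : ℕ} {α : Type*} [MeasurableSpace α] (μ : Measure α)
    (φ : α → Esp d) (g : α → ℝ) {m : ℕ} {k : Fin d →₀ ℕ} (hk : ∑ i, k i = m) :
    (momentPoly μ φ g m).coeff k =
      (Nat.multinomial Finset.univ k : ℝ) * ∫ a, g a * ∏ i, φ a i ^ k i ∂μ := by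
  rw [momentPoly, MvPolynomial.coeff_sum, Finset.sum_eq_single (k : Fin d → ℕ)]
  · simp
  · intro l _ hl
    rw [MvPolynomial.coeff_monomial, if_neg]
    rintro rfl
    exact hl (by simp)
  · intro h
    exact absurd (Finset.mem_piAntidiag.2 ⟨hk, by simp⟩) h

@[fun_prop]
theorem continuous_mvPolynomial_eval_euclidean {d : ℕ} (q : MvPolynomial (Fin d) ℝ) :
    Continuous fun x : Esp d ↦ MvPolynomial.eval (fun i ↦ x i) q :=
  (MvPolynomial.continuous_eval q).comp (by fun_prop)

theorem integral_mul_eval_eq_zero {d : ℕ} {g : Esp d → ℝ} (hg : Continuous g) {N : ℕ}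
    (h : ∀ m < N, ∀ η : Esp d, ∫ x in Metric.closedBall (0 : Esp d) 1, g x * ⟪x, η⟫ ^ m = 0)
    {q : MvPolynomial (Fin d) ℝ} (hq : q.totalDegree < N) :
    ∫ x in Metric.closedBall (0 : Esp d) 1, g x * MvPolynomial.eval (fun i ↦ x i) q = 0 := by
  have hmon (k : Fin d → ℕ) : Integrable (fun x : Esp d ↦ g x * ∏ i, x i ^ k i)
      (volume.restrict (Metric.closedBall (0 : Esp d) 1)) :=
    Continuous.integrableOn_closedBall (by fun_prop) _ _
  simp only [MvPolynomial.eval_eq', Finset.mul_sum, mul_left_comm (g _)]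
  rw [integral_finsetSum _ fun (k : Fin d →₀ ℕ) _ ↦ (hmon k).const_mul (q.coeff k)]
  refine Finset.sum_eq_zero fun k hk ↦ ?_
  rw [integral_const_mul]
  have hkN : ∑ i, k i < N := by
    refine lt_of_le_of_lt ?_ hq
    rw [← Finsupp.sum_fintype k (fun _ e ↦ e) fun _ ↦ rfl]
    exact MvPolynomial.le_totalDegree hk
  have hp : momentPoly (volume.restrict (Metric.closedBall (0 : Esp d) 1)) (fun x ↦ x) g
      (∑ i, k i) = 0 := by
    refine MvPolynomial.funext fun η ↦ ?_
    have := (eval_momentPoly (∑ i, k i) hmon (WithLp.toLp 2 η)).trans (h _ hkN _)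
    simpa using this
  have hc := coeff_momentPoly (volume.restrict (Metric.closedBall (0 : Esp d) 1)) (fun x ↦ x) g
    (k := k) rfl
  rw [hp, MvPolynomial.coeff_zero, zero_eq_mul, Nat.cast_eq_zero] at hc
  rw [hc.resolve_left (Nat.multinomial_pos _ _).ne', mul_zero]

theorem IsPolyDeg.continuous {d n : ℕ} {P : Esp d → ℝ} (h : IsPolyDeg d n P) : Continuous P := by
  obtain ⟨p, -, hp⟩ := h
  rw [funext hp]
  fun_prop

theorem IsPolyDeg.sub {d n : ℕ} {P Q : Esp d → ℝ} (hP : IsPolyDeg d n P) (hQ : IsPolyDeg d n Q) :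
    IsPolyDeg d n fun x ↦ P x - Q x := by
  obtain ⟨p, hp, hp'⟩ := hP
  obtain ⟨q, hq, hq'⟩ := hQ
  exact ⟨p - q, (MvPolynomial.totalDegree_sub p q).trans (max_le hp hq), fun x ↦ by
    simp [hp', hq']⟩

theorem IsPolyDeg.const_mul {d n : ℕ} {P : Esp d → ℝ} (hP : IsPolyDeg d n P) (c : ℝ) :
    IsPolyDeg d n fun x ↦ c * P x := by
  obtain ⟨p, hp, hp'⟩ := hP
  exact ⟨c • p, (MvPolynomial.totalDegree_smul_le c p).trans hp, fun x ↦ by simp [hp']⟩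

theorem IsPolyDeg.sum {d n : ℕ} {ι : Type*} {s : Finset ι} {P : ι → Esp d → ℝ}
    (hP : ∀ i ∈ s, IsPolyDeg d n (P i)) : IsPolyDeg d n fun x ↦ ∑ i ∈ s, P i x := by
  choose! p hp hp' using hP
  exact ⟨∑ i ∈ s, p i, MvPolynomial.totalDegree_finsetSum_le hp, fun x ↦ by
    rw [map_sum]
    exact Finset.sum_congr rfl fun i hi ↦ hp' i hi x⟩

theorem IsPolyDeg.mono {d m n : ℕ} {P : Esp d → ℝ} (hP : IsPolyDeg d m P) (hmn : m ≤ n) :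
    IsPolyDeg d n P := by
  obtain ⟨p, hp, hp'⟩ := hP
  exact ⟨p, hp.trans hmn, hp'⟩

theorem isPolyDeg_inner_pow {d : ℕ} (ξ : Esp d) (m : ℕ) : IsPolyDeg d m fun x ↦ ⟪x, ξ⟫ ^ m := by
  refine ⟨momentPoly (Measure.dirac ξ) id 1 m, totalDegree_momentPoly_le _ _ _ _, fun x ↦ ?_⟩
  rw [eval_momentPoly m fun k ↦ integrable_dirac (by simp)]
  simp [real_inner_comm]

theorem isPolyDeg_gegen_inner {d : ℕ} (lam : ℝ) (n : ℕ) (ξ : Esp d) :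
    IsPolyDeg d n fun x ↦ gegen lam n ⟪x, ξ⟫ := by
  simp only [gegen_eq_sum]
  exact .sum fun k _ ↦ ((isPolyDeg_inner_pow ξ _).mono (Nat.sub_le _ _)).const_mul _

theorem isPolyDeg_integral_sphere_mul_gegen {d : ℕ} (lam : ℝ) (n : ℕ)
    {g : Metric.sphere (0 : Esp d) 1 → ℝ} (hg : Continuous g) :
    IsPolyDeg d n fun x ↦ ∫ ξ, g ξ * gegen lam n ⟪x, (ξ : Esp d)⟫ ∂(sphereMeasure d) := by
  have h (x : Esp d) : ∫ ξ, g ξ * gegen lam n ⟪x, (ξ : Esp d)⟫ ∂(sphereMeasure d) =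
      ∑ k ∈ Finset.range (n / 2 + 1), gegenCoeff lam n k *
        ∫ ξ, g ξ * ⟪(ξ : Esp d), x⟫ ^ (n - 2 * k) ∂(sphereMeasure d) := by
    simp only [gegen_eq_sum, Finset.mul_sum]
    rw [integral_finsetSum _ fun i _ ↦ Continuous.integrable_sphereMeasure (by fun_prop)]
    simp only [mul_left_comm (g _), integral_const_mul, real_inner_comm x]
  simp only [h]
  refine .sum fun k _ ↦ .const_mul (.mono ?_ (Nat.sub_le n (2 * k))) _
  refine ⟨momentPoly (sphereMeasure d) Subtype.val g (n - 2 * k),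
    totalDegree_momentPoly_le _ _ _ _, fun x ↦ ?_⟩
  rw [eval_momentPoly _ fun k ↦ Continuous.integrable_sphereMeasure (by fun_prop)]

theorem integral_closedBall_integral_sphere_swap {d : ℕ}
    {F : Esp d → Metric.sphere (0 : Esp d) 1 → ℝ} (hF : Continuous (Function.uncurry F)) :
    ∫ x in Metric.closedBall (0 : Esp d) 1, ∫ ξ, F x ξ ∂(sphereMeasure d) =
      ∫ ξ, (∫ x in Metric.closedBall (0 : Esp d) 1, F x ξ) ∂(sphereMeasure d) := by
  refine integral_integral_swap ?_
  rw [← Measure.restrict_univ (μ := sphereMeasure d), Measure.prod_restrict]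
  exact hF.continuousOn.integrableOn_compact ((isCompact_closedBall _ _).prod isCompact_univ)

theorem memV_gegen_inner {d : ℕ} (hd : 1 ≤ d) {u : Esp d} (hu : ‖u‖ = 1) (n : ℕ) :
    MemV d n fun x ↦ gegen ((d : ℝ) / 2) n ⟪x, u⟫ := by
  refine ⟨isPolyDeg_gegen_inner _ n u, fun Q ⟨q, hq, hQ⟩ ↦ ?_⟩
  simp only [hQ]
  exact integral_mul_eval_eq_zero (by fun_prop)
    (fun m hm η ↦ integral_closedBall_gegen_mul_inner_pow_of_lt hd hu η hm) hq

theorem memV_integral_sphere_mul_gegen {d : ℕ} (hd : 1 ≤ d) (n : ℕ)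
    {g : Metric.sphere (0 : Esp d) 1 → ℝ} (hg : Continuous g) :
    MemV d n fun x ↦
      ∫ ξ, g ξ * gegen ((d : ℝ) / 2) n ⟪x, (ξ : Esp d)⟫ ∂(sphereMeasure d) := by
  refine ⟨isPolyDeg_integral_sphere_mul_gegen _ n hg, fun Q ⟨q, hq, hQ⟩ ↦ ?_⟩
  simp only [← integral_mul_const, mul_assoc]
  have hQc : Continuous Q := by
    rw [funext hQ]
    fun_prop
  rw [integral_closedBall_integral_sphere_swap (by fun_prop)]
  simp only [integral_const_mul]
  have h (ξ : Metric.sphere (0 : Esp d) 1) :=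
    (memV_gegen_inner hd (norm_eq_of_mem_sphere ξ) n).2 Q ⟨q, hq, hQ⟩
  simp [h]

theorem integral_closedBall_sub_mul {d : ℕ} {P Q R : Esp d → ℝ} (hP : Continuous P)
    (hQ : Continuous Q) (hR : Continuous R) :
    ∫ x in Metric.closedBall (0 : Esp d) 1, (P x - Q x) * R x =
      (∫ x in Metric.closedBall (0 : Esp d) 1, P x * R x) -
        ∫ x in Metric.closedBall (0 : Esp d) 1, Q x * R x := by
  simp only [sub_mul]
  exact integral_sub ((hP.mul hR).integrableOn_closedBall _ _)
    ((hQ.mul hR).integrableOn_closedBall _ _)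

theorem MemV.sub {d n : ℕ} {P Q : Esp d → ℝ} (hP : MemV d n P) (hQ : MemV d n Q) :
    MemV d n fun x ↦ P x - Q x := by
  refine ⟨hP.1.sub hQ.1, fun R hR ↦ ?_⟩
  have hRc : Continuous R := by
    obtain ⟨q, -, hq⟩ := hR
    rw [funext hq]
    fun_prop
  rw [integral_closedBall_sub_mul hP.1.continuous hQ.1.continuous hRc, hP.2 R hR, hQ.2 R hR, sub_zero]

theorem MemV.const_mul {d n : ℕ} {P : Esp d → ℝ} (hP : MemV d n P) (c : ℝ) :
    MemV d n fun x ↦ c * P x := by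
  refine ⟨hP.1.const_mul c, fun R hR ↦ ?_⟩
  simp only [mul_assoc]
  rw [integral_const_mul, hP.2 R hR, mul_zero]

theorem MemV.integral_mul_inner_pow_eq_zero {d n m : ℕ} {P : Esp d → ℝ} (hP : MemV d n P)
    (hmn : m < n) (η : Esp d) :
    ∫ x in Metric.closedBall (0 : Esp d) 1, P x * ⟪x, η⟫ ^ m = 0 := by
  obtain ⟨q, hq, hq'⟩ := isPolyDeg_inner_pow η m
  exact hP.2 _ ⟨q, hq.trans_lt hmn, hq'⟩

theorem MemV.integral_mul_gegen_inner {d n : ℕ} {P : Esp d → ℝ} (hP : MemV d n P) (lam : ℝ)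
    (η : Esp d) :
    ∫ x in Metric.closedBall (0 : Esp d) 1, P x * gegen lam n ⟪x, η⟫ =
      gegenCoeff lam n 0 * ∫ x in Metric.closedBall (0 : Esp d) 1, P x * ⟪x, η⟫ ^ n := by
  have hc := hP.1.continuous
  simp only [gegen_eq_sum, Finset.mul_sum, mul_left_comm (P _)]
  rw [integral_finsetSum _ fun k _ ↦ Continuous.integrableOn_closedBall (by fun_prop) _ _,
    Finset.sum_eq_single 0 (fun k hk hk0 ↦ ?_) (by simp), integral_const_mul]
  · simp
  · have hk := Finset.mem_range.1 hk
    rw [integral_const_mul, hP.integral_mul_inner_pow_eq_zero (by omega), mul_zero]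

theorem gegenCoeff_zero_pos {lam : ℝ} (hlam : 0 < lam) (n : ℕ) : 0 < gegenCoeff lam n 0 := by
  have h1 := Real.Gamma_pos_of_pos hlam
  have h2 := Real.Gamma_pos_of_pos (s := (n : ℝ) + lam) (by positivity)
  simp only [gegenCoeff, Nat.cast_zero, sub_zero]
  positivity

theorem MemV.integral_mul_eq_zero_of_integral_mul_gegen_eq_zero {d n : ℕ} (hd : 1 ≤ d)
    {P Q : Esp d → ℝ} (hP : MemV d n P) (hQ : IsPolyDeg d n Q)
    (h : ∀ u : Esp d, ‖u‖ = 1 →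
      ∫ x in Metric.closedBall (0 : Esp d) 1, P x * gegen ((d : ℝ) / 2) n ⟪x, u⟫ = 0) :
    ∫ x in Metric.closedBall (0 : Esp d) 1, P x * Q x = 0 := by
  obtain ⟨q, hq, hQ⟩ := hQ
  simp only [hQ]
  refine integral_mul_eval_eq_zero hP.1.continuous (fun m hm η ↦ ?_) (Nat.lt_succ_of_le hq)
  obtain hm | rfl := (Nat.lt_succ_iff.1 hm).lt_or_eq
  · exact hP.integral_mul_inner_pow_eq_zero hm η
  · obtain ⟨u, hu, hηu⟩ := exists_norm_eq_one_and_eq_norm_smul hd η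
    have hu' := h u hu
    rw [hP.integral_mul_gegen_inner, mul_eq_zero] at hu'
    have hu0 := hu'.resolve_left
      (gegenCoeff_zero_pos (by have : (0 : ℝ) < d := by exact_mod_cast hd
                               positivity) m).ne'
    rw [hηu]
    simp only [real_inner_smul_right, mul_pow, mul_left_comm (P _), integral_const_mul, hu0,
      mul_zero]

theorem integral_closedBall_gegen_mul_gegen {d : ℕ} (hd : 1 ≤ d) {u v : Esp d}
    (hu : ‖u‖ = 1) (hv : ‖v‖ = 1) (n : ℕ) :
    ∫ x in Metric.closedBall (0 : Esp d) 1,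
        gegen ((d : ℝ) / 2) n ⟪x, u⟫ * gegen ((d : ℝ) / 2) n ⟪x, v⟫ =
      sigmaConst d / (2 * ((n : ℝ) + (d : ℝ) / 2)) * gegen ((d : ℝ) / 2) n ⟪u, v⟫ := by
  rw [(memV_gegen_inner hd hu n).integral_mul_gegen_inner,
    integral_closedBall_gegen_mul_inner_pow_self hd hu hv]

theorem sigmaConst_eq_mul_ballVol {d : ℕ} (hd : 1 ≤ d) : sigmaConst d = d * ballVol d := by
  have hd0 : (0 : ℝ) < d := by exact_mod_cast hd
  have hG := Real.Gamma_pos_of_pos (s := (d : ℝ) / 2) (by positivity)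
  rw [sigmaConst, ballVol, add_div, div_self two_ne_zero, Real.Gamma_add_one (by positivity)]
  field_simp

theorem integral_closedBall_integral_sphere_mul_gegen {d : ℕ} (hd : 1 ≤ d) {u : Esp d}
    (hu : ‖u‖ = 1) (x : Esp d) (n : ℕ) :
    ∫ y in Metric.closedBall (0 : Esp d) 1, (∫ ξ : Metric.sphere (0 : Esp d) 1,
        gegen ((d : ℝ) / 2) n ⟪x, (ξ : Esp d)⟫ * gegen ((d : ℝ) / 2) n ⟪y, (ξ : Esp d)⟫
          ∂(sphereMeasure d)) * gegen ((d : ℝ) / 2) n ⟪y, u⟫ =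
      sigmaConst d ^ 2 / (2 * ((n : ℝ) + (d : ℝ) / 2)) * gegen ((d : ℝ) / 2) n ⟪x, u⟫ := by
  simp only [← integral_mul_const, mul_assoc]
  rw [integral_closedBall_integral_sphere_swap (by fun_prop)]
  simp only [integral_const_mul,
    integral_closedBall_gegen_mul_gegen hd (norm_eq_of_mem_sphere _) hu]
  simp only [mul_left_comm (gegen _ _ ⟪x, _⟫), integral_const_mul]
  have h := integral_sphere_gegen_mul_gegen hd hu x n
  simp only [real_inner_comm x, mul_comm (gegen _ _ ⟪(_ : Esp d), u⟫)] at h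
  rw [h]
  ring

/-- The reproducing kernel `P_n(·,·)` of `V_n^d` satisfies, for `x, y ∈ B^d`,
`P_n(x,y) = ((n+d/2)/(d/2)) σ_d^{-1} ∫_{S^{d-1}} C_n^{d/2}(⟨x,ξ⟩) C_n^{d/2}(⟨y,ξ⟩) dω(ξ)`. -/
theorem reproducing_kernel_sphere_formula (d n : ℕ) (hd : 1 ≤ d)
    (Pn : Esp d → Esp d → ℝ)
    (hker : ∀ x ∈ Metric.closedBall (0 : Esp d) 1, MemV d n (fun y => Pn x y))
    (hrepr : ∀ f : Esp d → ℝ, MemV d n f → ∀ x ∈ Metric.closedBall (0 : Esp d) 1,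
      (ballVol d)⁻¹ * ∫ y in Metric.closedBall (0 : Esp d) 1, f y * Pn x y = f x)
    (x y : Esp d) (hx : x ∈ Metric.closedBall (0 : Esp d) 1)
    (hy : y ∈ Metric.closedBall (0 : Esp d) 1) :
    Pn x y = (((n : ℝ) + (d : ℝ) / 2) / ((d : ℝ) / 2)) * (sigmaConst d)⁻¹ *
      ∫ ξ : Metric.sphere (0 : Esp d) 1,
        gegen ((d : ℝ) / 2) n ⟪x, (ξ : Esp d)⟫ * gegen ((d : ℝ) / 2) n ⟪y, (ξ : Esp d)⟫
          ∂(sphereMeasure d) := by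
  have hd0 : (0 : ℝ) < d := by exact_mod_cast hd
  set c := ((n : ℝ) + (d : ℝ) / 2) / ((d : ℝ) / 2) * (sigmaConst d)⁻¹ with hc
  have hσ := sigmaConst_pos hd
  have hb : 0 < ballVol d := by
    rw [sigmaConst_eq_mul_ballVol hd] at hσ
    exact pos_of_mul_pos_right hσ hd0.le
  have hK : MemV d n fun z ↦ c * ∫ ξ : Metric.sphere (0 : Esp d) 1,
      gegen ((d : ℝ) / 2) n ⟪x, (ξ : Esp d)⟫ * gegen ((d : ℝ) / 2) n ⟪z, (ξ : Esp d)⟫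
        ∂(sphereMeasure d) :=
    (memV_integral_sphere_mul_gegen hd n (by fun_prop)).const_mul c
  have hD := (hker x hx).sub hK
  have hortho := hD.integral_mul_eq_zero_of_integral_mul_gegen_eq_zero hd (hker y hy).1
    fun u hu ↦ by
      have hcg : Continuous fun z : Esp d ↦ gegen ((d : ℝ) / 2) n ⟪z, u⟫ := by fun_prop
      have h1 := hrepr _ (memV_gegen_inner hd hu n) x hx
      simp only [mul_comm (gegen _ _ _)] at h1
      rw [integral_closedBall_sub_mul (hker x hx).1.continuous hK.1.continuous hcg,
        (inv_mul_eq_iff_eq_mul₀ hb.ne').1 h1]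
      simp only [mul_assoc]
      rw [integral_const_mul, integral_closedBall_integral_sphere_mul_gegen hd hu, hc,
        sigmaConst_eq_mul_ballVol hd]
      field_simp
      ring
  have hDy := hrepr _ hD y hy
  rw [hortho, mul_zero] at hDy
  exact sub_eq_zero.1 hDy.symm
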